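/- Let (Γ, ι) be a computable group with a canonically computable right Følner sequence (F_n)_{n≥1} such that |F_n|/log n → ∞ as n → ∞, let Λ be a finite alphabet and X ⊆ Λ^Γ a subshift. Then for every t ∈ ℝ_{≥0} the sets E_t := {ω ∈ X : K̂(ω) = t}, L_t := {ω ∈ X : K̂(ω) < t} and G_t := {ω ∈ X : K̂(ω) > t} are Borel measurable and invariant under the Γ-action, where K̂ denotes asymptotic Kolmogorov complexity along (F_n). -/

import Mathlib

open scoped Pointwise
open Filter Topology

/-- `(F n)` is a right Følner sequence. -/
def IsRightFolner {Γ : Type*} [Group Γ] [DecidableEq Γ] (F : ℕ → Finset Γ) : Prop :=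
  (∀ n, (F n).Nonempty) ∧
    ∀ K : Finset Γ,
      Tendsto (fun n => ((symmDiff (F n) (F n * K)).card : ℝ) / (F n).card) atTop (𝓝 0)

/-- `(ι : Γ → ℕ)` is an admissible indexing. -/
def IsComputableGroup {Γ : Type*} [Group Γ] (ι : Γ → ℕ) : Prop :=
  Function.Injective ι ∧
    (∃ χ : ℕ → Bool, Computable χ ∧ ∀ m, χ m = true ↔ m ∈ Set.range ι) ∧
    ∃ m : ℕ → ℕ → ℕ, Computable₂ m ∧ ∀ a b : Γ, m (ι a) (ι b) = ι (a * b)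

/-- Canonically computable sequence of finite subsets. -/
def CanonicallyComputable {X : Type*} (ι : X → ℕ) (F : ℕ → Finset X) : Prop :=
  Computable fun n => ∑ x ∈ (F n).image ι, 2 ^ x

/-- Kolmogorov complexity of `w` w.r.t. the decompressor `A`. -/
noncomputable def KC {Λ : Type*} (A : List Bool →. List Λ) (w : List Λ) : ℕ :=
  sInf {l : ℕ | ∃ p : List Bool, p.length = l ∧ w ∈ A p}

/-- `A` is an optimal decompressor. -/
def IsOptimalDecompressor {Λ : Type*} [Primcodable Λ] (A : List Bool →. List Λ) : Prop :=
  Partrec A ∧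
    ∀ B : List Bool →. List Λ, Partrec B → ∃ c : ℕ,
      ∀ (w : List Λ) (p : List Bool), w ∈ B p →
        ∃ q : List Bool, w ∈ A q ∧ q.length ≤ p.length + c

/-- The `Λ`-string obtained by reading `ω` on `F` in the increasing order of `ι`. -/
noncomputable def wordString {X : Type*} [Nonempty X] {Λ : Type*}
    (ι : X → ℕ) (F : Finset X) (ω : X → Λ) : List Λ :=
  ((F.image ι).sort (· ≤ ·)).map fun m => ω (Function.invFun ι m)

/-- Asymptotic Kolmogorov complexity of `ω : Γ → Λ` along the sequence `(F n)`. -/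
noncomputable def Khat {Γ : Type*} [Nonempty Γ] {Λ : Type*}
    (A : List Bool →. List Λ) (ι : Γ → ℕ) (F : ℕ → Finset Γ) (ω : Γ → Λ) : ℝ :=
  limsup (fun n => (KC A (wordString ι (F n) ω) : ℝ) / (F n).card) atTop

/-- The shift action of `Γ` on `Λ^Γ`: `(g · ω)(x) = ω(x g)`. -/
def shiftAct {Γ : Type*} [Group Γ] {Λ : Type*} (g : Γ) (ω : Γ → Λ) : Γ → Λ :=
  fun x => ω (x * g)

/-- The positions of the nonzero binary digits of a natural number form a primitive recursive
list. -/
theorem primrec_bitIndices : Primrec Nat.bitIndices := by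
  have hR : PrimrecRel fun i N : ℕ => N / 2 ^ i % 2 = 1 := by
    have hpow : Primrec₂ ((· ^ ·) : ℕ → ℕ → ℕ) := Primrec₂.unpaired'.1 Nat.Primrec.pow
    exact Primrec.eq.comp
      (Primrec.nat_mod.comp (Primrec.nat_div.comp Primrec.snd
        (hpow.comp (Primrec.const 2) Primrec.fst)) (Primrec.const 2)) (Primrec.const 1)
  refine (hR.listFilter.comp Primrec.list_range Primrec.id).of_eq fun N => ?_
  refine List.Perm.eq_of_pairwise' (r := (· < ·)) ?_ ?_ ?_
  · exact (List.pairwise_lt_range).filter _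
  · exact Nat.bitIndices_sorted.pairwise
  · rw [List.perm_ext_iff_of_nodup (List.nodup_range.filter _) Nat.bitIndices_nodup]
    intro i
    have h : i ∈ N.bitIndices → i < N := fun hi =>
      Nat.lt_two_pow_self.trans_le (Nat.two_pow_le_of_mem_bitIndices hi)
    rw [Nat.mem_bitIndices, Nat.testBit_eq_decide_div_mod_eq, decide_eq_true_iff] at h ⊢
    simp only [id, List.mem_filter, List.mem_range, decide_eq_true_iff]
    tauto

theorem sort_eq_bitIndices (s : Finset ℕ) :
    s.sort (· ≤ ·) = (∑ x ∈ s, 2 ^ x).bitIndices := by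
  refine List.Perm.eq_of_pairwise' (r := (· < ·)) ?_ ?_ ?_
  · exact (Finset.sortedLT_sort s).pairwise
  · exact Nat.bitIndices_sorted.pairwise
  · rw [List.perm_ext_iff_of_nodup (Finset.sort_nodup _ _) Nat.bitIndices_nodup]
    intro i
    rw [← List.mem_toFinset, ← List.mem_toFinset, Finset.sort_toFinset,
      Finset.toFinset_bitIndices_sum_two_pow]

theorem Computable.list_map {α β : Type*} [Primcodable α] [Primcodable β] {f : α → β}
    (hf : Computable f) : Computable (List.map f) := by
  have hstep : Computable₂ fun (l : List α) (p : ℕ × List β) =>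
      ((l[p.1]?).map fun a => p.2 ++ [f a]).getD [] := by
    refine Computable.option_getD (Computable.option_map ?_ ?_) (Computable.const [])
    · exact Computable.list_getElem?.comp Computable.fst (Computable.fst.comp Computable.snd)
    · exact Computable.list_concat.comp
        (Computable.snd.comp (Computable.snd.comp Computable.fst)) (hf.comp Computable.snd)
  refine (Computable.nat_rec Computable.list_length (Computable.const []) hstep).of_eq fun l => ?_
  have key : ∀ n ≤ l.length, Nat.rec (motive := fun _ => List β) []
      (fun y IH => ((l[y]?).map fun a => IH ++ [f a]).getD []) n = (l.take n).map f := by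
    intro n hn
    induction n with
    | zero => simp
    | succ n ih =>
      have hn' : n < l.length := hn
      change ((l[n]?).map fun a => _ ++ [f a]).getD [] = _
      rw [ih hn'.le, List.take_add_one, List.getElem?_eq_getElem hn']
      simp only [Option.map_some, Option.getD_some, Option.toList_some, List.map_append,
        List.map_cons, List.map_nil]
  simpa using key l.length le_rfl

theorem exists_partrec_leftInverse {α β : Type*} [Primcodable α] [Primcodable β]
    {E : α → β} (hE : Computable E) (hinj : Function.Injective E) :
    ∃ D : β →. α, Partrec D ∧ ∀ x, x ∈ D (E x) := by
  classical
  have hc : Computable₂ fun (s : β) (k : ℕ) =>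
      (Encodable.decode (α := α) k).bind fun x => if E x = s then some x else none := by
    refine Computable.option_bind (Computable.decode.comp Computable.snd) ?_
    have hp : Primrec₂ fun (x : α) (p : β × β) => if p.1 = p.2 then some x else none :=
      Primrec.ite (Primrec.eq.comp (Primrec.fst.comp Primrec.snd) (Primrec.snd.comp Primrec.snd))
        (Primrec.option_some.comp Primrec.fst) (Primrec.const none)
    exact hp.to_comp.comp Computable.snd
      ((hE.comp Computable.snd).pair (Computable.fst.comp Computable.fst))
  refine ⟨_, Partrec.rfindOpt hc, fun x => ?_⟩
  have hdom := Nat.rfindOpt_dom (f := fun k =>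
    (Encodable.decode (α := α) k).bind fun y => if E y = E x then some y else none) |>.2
      ⟨Encodable.encode x, x, by simp⟩
  obtain ⟨y, hy⟩ := Part.dom_iff_mem.1 hdom
  obtain ⟨k, hk⟩ := Nat.rfindOpt_spec hy
  obtain ⟨z, -, hz⟩ := Option.bind_eq_some_iff.1 hk
  split_ifs at hz with h
  obtain rfl : z = y := by simpa using hz
  rwa [hinj h] at hy

/-- A self-delimiting binary code for lists of natural numbers: the entry `m` is written as
`m + 1` ones followed by a zero, and the list is terminated by a further zero. -/
def unaryCode (l : List ℕ) : List Bool :=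
  (l.flatMap fun m => true :: (List.replicate m true ++ [false])) ++ [false]

theorem replicate_true_append_inj {m m' : ℕ} {x y : List Bool}
    (h : List.replicate m true ++ false :: x = List.replicate m' true ++ false :: y) :
    m = m' ∧ x = y := by
  induction m generalizing m' with
  | zero => cases m' <;> simp_all [List.replicate_succ]
  | succ m ih =>
    cases m' with
    | zero => simp [List.replicate_succ] at h
    | succ m' =>
      simp only [List.replicate_succ, List.cons_append, List.cons.injEq, true_and] at h
      simpa using ih h

theorem unaryCode_append_inj {l l' : List ℕ} {x y : List Bool}
    (h : unaryCode l ++ x = unaryCode l' ++ y) : l = l' ∧ x = y := by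
  induction l generalizing l' with
  | nil => cases l' <;> simp_all [unaryCode]
  | cons a l ih =>
    cases l' with
    | nil => simp [unaryCode] at h
    | cons a' l' =>
      simp only [unaryCode, List.flatMap_cons, List.cons_append, List.append_assoc,
        List.cons.injEq, true_and, List.nil_append] at h
      obtain ⟨rfl, h'⟩ := replicate_true_append_inj h
      obtain ⟨rfl, rfl⟩ := ih (l' := l') (by simpa [unaryCode] using h')
      exact ⟨rfl, rfl⟩

theorem primrec_unaryCode : Primrec unaryCode := by
  have hrep : Primrec fun m : ℕ => List.replicate m true :=
    (Primrec.list_map Primrec.list_range (Primrec.const true).to₂).of_eq fun m => by simp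
  refine Primrec.list_append.comp (Primrec.list_flatMap Primrec.id ?_) (Primrec.const [false])
  exact Primrec.list_cons.comp (Primrec.const true)
    (Primrec.list_append.comp (hrep.comp Primrec.snd) (Primrec.const [false]))

theorem length_unaryCode_le {l : List ℕ} {M : ℕ} (h : ∀ m ∈ l, m ≤ M) :
    (unaryCode l).length ≤ (M + 2) * l.length + 1 := by
  induction l with
  | nil => simp [unaryCode]
  | cons a l ih =>
    have h1 := ih fun m hm => h m (List.mem_cons_of_mem _ hm)
    have h2 := h a List.mem_cons_self
    simp only [unaryCode, List.flatMap_cons, List.length_append, List.length_cons,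
      List.length_replicate, List.length_nil] at h1 ⊢
    linarith

/-- Reads off the values at the positions `R` of a function whose values at the positions `s` are
listed in `w`, and whose values at the positions of `R` outside `s` are listed in `l`. -/
def rebuild {Λ : Type*} (d : Λ) (s R : List ℕ) (w l : List Λ) : List Λ :=
  R.map fun m => ((w ++ l)[(s ++ R.filter (· ∉ s)).idxOf m]?).getD d

theorem rebuild_map {Λ : Type*} (d : Λ) (s R : List ℕ) (v : ℕ → Λ) :
    rebuild d s R (s.map v) ((R.filter (· ∉ s)).map v) = R.map v := by
  refine List.map_congr_left fun m hm => ?_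
  have hmem : m ∈ s ++ R.filter (· ∉ s) := by
    by_cases h : m ∈ s <;> simp [h, hm]
  rw [← List.map_append, List.getElem?_map,
    List.getElem?_eq_getElem (List.idxOf_lt_length_of_mem hmem)]
  simp [List.getElem_idxOf]

theorem primrec_rebuild {Λ : Type*} [Primcodable Λ] (d : Λ) :
    Primrec fun x : (List ℕ × List ℕ) × (List Λ × List Λ) =>
      rebuild d x.1.1 x.1.2 x.2.1 x.2.2 := by
  have hmem : PrimrecRel fun (m : ℕ) (s : List ℕ) => m ∉ s := by
    have h := (PrimrecRel.exists_mem_list (R := fun a b : ℕ => a = b) Primrec.eq).comp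
      (Primrec.snd (α := ℕ) (β := List ℕ)) (Primrec.fst (α := ℕ) (β := List ℕ))
    exact (h.not).of_eq fun x => by simp
  have hfilter : Primrec₂ fun (R s : List ℕ) => R.filter (· ∉ s) := hmem.listFilter
  refine Primrec.list_map (Primrec.snd.comp Primrec.fst) ?_
  refine Primrec.option_getD.comp ?_ (Primrec.const d)
  refine Primrec.list_getElem?.comp ?_ (Primrec.list_idxOf.comp Primrec.snd ?_)
  · exact Primrec.list_append.comp
      (Primrec.fst.comp (Primrec.snd.comp Primrec.fst))
      (Primrec.snd.comp (Primrec.snd.comp Primrec.fst))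
  · exact Primrec.list_append.comp
      (Primrec.fst.comp (Primrec.fst.comp Primrec.fst))
      (hfilter.comp (Primrec.snd.comp (Primrec.fst.comp Primrec.fst))
        (Primrec.fst.comp (Primrec.fst.comp Primrec.fst)))

section Complexity

variable {Λ : Type*} {A : List Bool →. List Λ}

theorem KC_le_length {w : List Λ} {p : List Bool} (h : w ∈ A p) : KC A w ≤ p.length :=
  Nat.sInf_le ⟨p, rfl, h⟩

theorem IsOptimalDecompressor.exists_length_eq_KC [Primcodable Λ] (hA : IsOptimalDecompressor A)
    (w : List Λ) : ∃ p : List Bool, p.length = KC A w ∧ w ∈ A p := by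
  obtain ⟨c, hc⟩ := hA.2 (fun p => (Encodable.decode (α := List Λ) p.length : Part (List Λ)))
    (Computable.decode.comp Computable.list_length).ofOption
  obtain ⟨q, hq, -⟩ := hc w (List.replicate (Encodable.encode w) true) (by simp)
  exact Nat.sInf_mem (s := {l : ℕ | ∃ p : List Bool, p.length = l ∧ w ∈ A p}) ⟨q.length, q, rfl, hq⟩

/-- A program for the values at the positions `R n` consists of `n`, the values at the positions
of `R n` outside `s n`, and a program for the values at the positions `s n`. -/
theorem IsOptimalDecompressor.exists_KC_map_le [Fintype Λ] [Primcodable Λ]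
    (hA : IsOptimalDecompressor A)
    {s R : ℕ → List ℕ} (hs : Computable s) (hR : Computable R) :
    ∃ c : ℕ, ∀ (n : ℕ) (v : ℕ → Λ),
      KC A ((R n).map v) ≤ KC A ((s n).map v) +
        (c * (Nat.log 2 n + 1) + c * ((R n).filter (· ∉ s n)).length) := by
  rcases isEmpty_or_nonempty Λ with hΛ | ⟨⟨d⟩⟩
  · exact ⟨0, fun n v => (hΛ.false (v 0)).elim⟩
  obtain ⟨M, hM⟩ : ∃ M, ∀ a : Λ, Encodable.encode a ≤ M :=
    ⟨Finset.univ.sup Encodable.encode, fun a => Finset.le_sup (Finset.mem_univ a)⟩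
  let E : List ℕ × List Λ × List Bool → List Bool := fun x =>
    unaryCode x.1 ++ (unaryCode (x.2.1.map Encodable.encode) ++ x.2.2)
  have hE : Computable E := by
    refine (Primrec.list_append.comp (primrec_unaryCode.comp Primrec.fst)
      (Primrec.list_append.comp (primrec_unaryCode.comp (Primrec.list_map
        (Primrec.fst.comp Primrec.snd) (Primrec.encode.comp Primrec.snd).to₂))
        (Primrec.snd.comp Primrec.snd))).to_comp
  have hinj : Function.Injective E := by
    rintro ⟨b, l, p⟩ ⟨b', l', p'⟩ h
    obtain ⟨rfl, h⟩ := unaryCode_append_inj h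
    obtain ⟨h, rfl⟩ := unaryCode_append_inj h
    obtain rfl := List.map_injective_iff.2 Encodable.encode_injective h
    rfl
  obtain ⟨D, hD, hDE⟩ := exists_partrec_leftInverse hE hinj
  have hdigits : Primrec (Nat.ofDigits 2 : List ℕ → ℕ) := by
    refine (Primrec.list_foldr Primrec.id (Primrec.const 0)
      (h := fun _ p => p.1 + 2 * p.2) ?_).of_eq fun l => (Nat.ofDigits_eq_foldr 2 l).symm
    exact Primrec.nat_add.comp (Primrec.fst.comp Primrec.snd)
      (Primrec.nat_mul.comp (Primrec.const 2) (Primrec.snd.comp Primrec.snd))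
  let B : List Bool →. List Λ := fun q => (D q).bind fun x => (A x.2.2).map fun w =>
    rebuild d (s (Nat.ofDigits 2 x.1)) (R (Nat.ofDigits 2 x.1)) w x.2.1
  have hB : Partrec B := by
    refine hD.bind (Partrec.map ?_ ?_)
    · exact hA.1.comp (Computable.snd.comp (Computable.snd.comp Computable.snd))
    · have hn : Computable fun y : (List Bool × List ℕ × List Λ × List Bool) × List Λ =>
          Nat.ofDigits 2 y.1.2.1 :=
        hdigits.to_comp.comp (Computable.fst.comp (Computable.snd.comp Computable.fst))
      have hx : Computable fun y : (List Bool × List ℕ × List Λ × List Bool) × List Λ =>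
          ((s (Nat.ofDigits 2 y.1.2.1), R (Nat.ofDigits 2 y.1.2.1)), (y.2, y.1.2.2.1)) :=
        ((hs.comp hn).pair (hR.comp hn)).pair (Computable.snd.pair
          (Computable.fst.comp (Computable.snd.comp (Computable.snd.comp Computable.fst))))
      have hy := (primrec_rebuild d).to_comp.comp hx
      exact hy
  obtain ⟨c, hc⟩ := hA.2 B hB
  refine ⟨M + c + 6, fun n v => ?_⟩
  obtain ⟨p, hp, hpA⟩ := hA.exists_length_eq_KC ((s n).map v)
  let l := ((R n).filter (· ∉ s n)).map v
  have hmem : (R n).map v ∈ B (E (Nat.digits 2 n, l, p)) := by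
    refine Part.mem_bind_iff.2 ⟨_, hDE _, (Part.mem_map_iff _).2 ⟨_, hpA, ?_⟩⟩
    simp only [Nat.ofDigits_digits]
    exact rebuild_map d (s n) (R n) v
  obtain ⟨q, hq, hlen⟩ := hc _ _ hmem
  have h1 : (unaryCode (Nat.digits 2 n)).length ≤ (1 + 2) * (Nat.digits 2 n).length + 1 :=
    length_unaryCode_le fun m hm => Nat.le_of_lt_succ (Nat.digits_lt_base one_lt_two hm)
  have h2 : (unaryCode (l.map Encodable.encode)).length ≤
      (M + 2) * (l.map Encodable.encode).length + 1 :=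
    length_unaryCode_le fun m hm => by
      obtain ⟨a, -, rfl⟩ := List.mem_map.1 hm
      exact hM a
  have h3 : (Nat.digits 2 n).length ≤ Nat.log 2 n + 1 := by
    rcases eq_or_ne n 0 with rfl | hn
    · simp
    · rw [Nat.length_digits 2 n one_lt_two hn]
  simp only [E, List.length_append, List.length_map, l] at h2 hlen ⊢
  have h4 := KC_le_length hq
  nlinarith [Nat.zero_le (Nat.log 2 n), Nat.zero_le ((R n).filter (· ∉ s n)).length,
    Nat.zero_le (M * Nat.log 2 n), Nat.zero_le (c * Nat.log 2 n),
    Nat.zero_le (c * ((R n).filter (· ∉ s n)).length)]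

end Complexity

section Limsup

variable {a b δ : ℕ → ℝ}

theorem limsup_le_limsup_of_le_add_of_tendsto_zero (hb : ∀ n, 0 ≤ b n)
    (hδ : Tendsto δ atTop (𝓝 0)) (hba : ∀ n, b n ≤ a n + δ n)
    (hbdd : IsBoundedUnder (· ≤ ·) atTop a) : limsup b atTop ≤ limsup a atTop := by
  refine le_of_forall_pos_le_add fun ε hε => ?_
  have h1 : ∀ᶠ n in atTop, a n < limsup a atTop + ε / 2 :=
    eventually_lt_of_limsup_lt (lt_add_of_pos_right _ (half_pos hε)) hbdd
  have h2 : ∀ᶠ n in atTop, δ n < ε / 2 := hδ.eventually_lt_const (half_pos hε)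
  refine limsup_le_of_le (isCoboundedUnder_le_of_le atTop hb) ?_
  filter_upwards [h1, h2] with n h1 h2
  linarith [hba n]

theorem isBoundedUnder_of_le_add_of_tendsto_zero
    (hδ : Tendsto δ atTop (𝓝 0)) (hba : ∀ n, b n ≤ a n + δ n)
    (hbdd : IsBoundedUnder (· ≤ ·) atTop a) : IsBoundedUnder (· ≤ ·) atTop b := by
  obtain ⟨M, hM⟩ := hbdd.eventually_le
  refine ⟨M + 1, eventually_map.2 ?_⟩
  filter_upwards [hM, hδ.eventually_lt_const one_pos] with n h1 h2
  linarith [hba n]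

theorem limsup_eq_limsup_of_le_add_of_tendsto_zero {δ' : ℕ → ℝ} (ha : ∀ n, 0 ≤ a n)
    (hb : ∀ n, 0 ≤ b n) (hδ : Tendsto δ atTop (𝓝 0)) (hδ' : Tendsto δ' atTop (𝓝 0))
    (hba : ∀ n, b n ≤ a n + δ n) (hab : ∀ n, a n ≤ b n + δ' n) :
    limsup b atTop = limsup a atTop := by
  by_cases hbdd : IsBoundedUnder (· ≤ ·) atTop a
  · exact le_antisymm (limsup_le_limsup_of_le_add_of_tendsto_zero hb hδ hba hbdd)
      (limsup_le_limsup_of_le_add_of_tendsto_zero ha hδ' hab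
        (isBoundedUnder_of_le_add_of_tendsto_zero hδ hba hbdd))
  · rw [Real.limsup_of_not_isBoundedUnder hbdd, Real.limsup_of_not_isBoundedUnder fun h =>
      hbdd (isBoundedUnder_of_le_add_of_tendsto_zero hδ' hab h)]

end Limsup

theorem tendsto_natLog_add_one_div {k : ℕ → ℕ}
    (hgrowth : Tendsto (fun n => (k n : ℝ) / Real.log n) atTop atTop) :
    Tendsto (fun n => ((Nat.log 2 n : ℝ) + 1) / k n) atTop (𝓝 0) := by
  have h : Tendsto (fun n : ℕ => 4 * (Real.log n / k n)) atTop (𝓝 0) := by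
    simpa using hgrowth.inv_tendsto_atTop.const_mul 4
  refine squeeze_zero' (Eventually.of_forall fun n => by positivity) ?_ h
  filter_upwards [eventually_ge_atTop 2] with n hn
  rw [← mul_div_assoc]
  gcongr
  have hlog2 : (1 : ℝ) / 2 ≤ Real.log 2 := by linarith [Real.log_two_gt_d9]
  have h1 : Real.log 2 ≤ Real.log n := Real.log_le_log two_pos (by exact_mod_cast hn)
  have h2 : (Nat.log 2 n : ℝ) * Real.log 2 ≤ Real.log n := by
    rw [← Real.log_pow]
    exact Real.log_le_log (by positivity)
      (by exact_mod_cast Nat.pow_log_le_self 2 (by lia : n ≠ 0))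
  nlinarith [(Nat.log 2 n).cast_nonneg (α := ℝ)]

theorem measurable_comp_wordString {X Λ β : Type*} [Nonempty X] [Finite Λ] [MeasurableSpace Λ]
    [MeasurableSingletonClass Λ] [MeasurableSpace β] (ι : X → ℕ) (F : Finset X)
    (f : List Λ → β) : Measurable fun ω : X → Λ => f (wordString ι F ω) := by
  set L := (F.image ι).sort (· ≤ ·) with hL
  have h : Measurable fun (ω : X → Λ) (i : Fin L.length) => ω (Function.invFun ι L[i]) :=
    measurable_pi_lambda _ fun i => measurable_pi_apply _
  have hf : Measurable fun u : Fin L.length → Λ => f (List.ofFn u) := .of_discrete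
  have hword : ∀ ω : X → Λ, wordString ι F ω =
      List.ofFn fun i : Fin L.length => ω (Function.invFun ι L[i]) := fun ω =>
    List.ext_getElem (by simp [wordString, hL]) (by simp [wordString, hL])
  simp only [hword]
  exact hf.comp h

theorem measurable_Khat {Γ Λ : Type*} [Nonempty Γ] [Finite Λ] [MeasurableSpace Λ]
    [MeasurableSingletonClass Λ] (A : List Bool →. List Λ) (ι : Γ → ℕ) (F : ℕ → Finset Γ) :
    Measurable (Khat A ι F) :=
  Measurable.limsup fun n =>
    measurable_comp_wordString ι (F n) fun w => (KC A w : ℝ) / (F n).card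

section Shift

variable {Γ Λ : Type*} [Group Γ]

theorem shiftAct_shiftAct (g h : Γ) (ω : Γ → Λ) :
    shiftAct g (shiftAct h ω) = shiftAct (g * h) ω := by
  funext x
  simp [shiftAct, mul_assoc]

theorem shiftAct_one (ω : Γ → Λ) : shiftAct 1 ω = ω := by
  funext x
  simp [shiftAct]

/-- A set cut out of an invariant set by an invariant predicate is invariant. -/
theorem shiftAct_image_sep {X : Set (Γ → Λ)} (hX : ∀ g : Γ, ∀ ω ∈ X, shiftAct g ω ∈ X)
    {P : (Γ → Λ) → Prop} (hP : ∀ g ω, P ω → P (shiftAct g ω)) (g : Γ) :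
    shiftAct g '' {ω | ω ∈ X ∧ P ω} = {ω | ω ∈ X ∧ P ω} := by
  ext ω
  constructor
  · rintro ⟨ω, ⟨h1, h2⟩, rfl⟩
    exact ⟨hX g ω h1, hP g ω h2⟩
  · rintro ⟨h1, h2⟩
    refine ⟨shiftAct g⁻¹ ω, ⟨hX _ _ h1, hP _ _ h2⟩, ?_⟩
    rw [shiftAct_shiftAct, mul_inv_cancel, shiftAct_one]

theorem length_filter_translate_le [DecidableEq Γ] {ι : Γ → ℕ} (hι : Function.Injective ι)
    {m : ℕ → ℕ → ℕ} (hm : ∀ a b : Γ, m (ι a) (ι b) = ι (a * b)) {F : Finset Γ} {L : List ℕ}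
    (hL : L.Nodup) (hmem : ∀ a, a ∈ L ↔ ∃ x ∈ F, ι x = a) (g : Γ) :
    ((L.map fun a => m a (ι g)).filter (· ∉ L)).length ≤ (symmDiff F (F * {g})).card := by
  have hnodup : (L.map fun a => m a (ι g)).Nodup := by
    refine hL.map_on fun a ha b hb h => ?_
    obtain ⟨x, -, rfl⟩ := (hmem a).1 ha
    obtain ⟨y, -, rfl⟩ := (hmem b).1 hb
    rw [hm, hm] at h
    rw [mul_right_cancel (hι h)]
  have hsub : ((L.map fun a => m a (ι g)).filter (· ∉ L)).toFinset ⊆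
      (symmDiff F (F * {g})).image ι := by
    intro a ha
    rw [List.mem_toFinset, List.mem_filter, List.mem_map, decide_eq_true_eq] at ha
    obtain ⟨⟨b, hb, rfl⟩, hnot⟩ := ha
    obtain ⟨x, hx, rfl⟩ := (hmem b).1 hb
    rw [hm, hmem] at hnot
    rw [hm]
    refine Finset.mem_image_of_mem ι (Finset.mem_symmDiff.2 (Or.inr ⟨?_, fun h => ?_⟩))
    · exact Finset.mul_mem_mul hx (Finset.mem_singleton_self g)
    · exact hnot ⟨x * g, h, rfl⟩
  have hcard := Finset.card_le_card hsub
  rw [List.toFinset_card_of_nodup (hnodup.filter _)] at hcard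
  exact hcard.trans Finset.card_image_le

variable [DecidableEq Γ] [Fintype Λ] [Primcodable Λ] {ι : Γ → ℕ} {F : ℕ → Finset Γ}
  {A : List Bool →. List Λ}

theorem exists_KC_shiftAct_div_card_le (hcg : IsComputableGroup ι) (hF : IsRightFolner F)
    (hcc : CanonicallyComputable ι F)
    (hgrowth : Tendsto (fun n => ((F n).card : ℝ) / Real.log n) atTop atTop)
    (hA : IsOptimalDecompressor A) (g : Γ) :
    ∃ δ : ℕ → ℝ, Tendsto δ atTop (𝓝 0) ∧ ∀ (ω : Γ → Λ) (n : ℕ),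
      (KC A (wordString ι (F n) (shiftAct g ω)) : ℝ) / (F n).card ≤
        (KC A (wordString ι (F n) ω) : ℝ) / (F n).card + δ n := by
  obtain ⟨hι, -, m, hmc, hm⟩ := hcg
  let s : ℕ → List ℕ := fun n => ((F n).image ι).sort (· ≤ ·)
  let R : ℕ → List ℕ := fun n => (s n).map fun a => m a (ι g)
  have hs : Computable s :=
    (primrec_bitIndices.to_comp.comp hcc).of_eq fun n => (sort_eq_bitIndices _).symm
  have hR : Computable R :=
    (Computable.list_map (hmc.comp Computable.id (Computable.const (ι g)))).comp hs
  obtain ⟨c, hc⟩ := hA.exists_KC_map_le hs hR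
  refine ⟨fun n => c * (((Nat.log 2 n : ℝ) + 1) / (F n).card) +
    c * (((symmDiff (F n) (F n * {g})).card : ℝ) / (F n).card), ?_, fun ω n => ?_⟩
  · simpa using ((tendsto_natLog_add_one_div hgrowth).const_mul (c : ℝ)).add
      ((hF.2 {g}).const_mul (c : ℝ))
  · have hword : wordString ι (F n) (shiftAct g ω) =
        (R n).map fun a => ω (Function.invFun ι a) := by
      simp only [wordString, R, s, List.map_map]
      refine List.map_congr_left fun a ha => ?_
      obtain ⟨x, -, rfl⟩ := Finset.mem_image.1 ((Finset.mem_sort _).1 ha)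
      simp [shiftAct, hm, Function.leftInverse_invFun hι _]
    have h1 := hc n fun a => ω (Function.invFun ι a)
    rw [← hword] at h1
    have h2 : ((R n).filter (· ∉ s n)).length ≤ (symmDiff (F n) (F n * {g})).card :=
      length_filter_translate_le hι hm (Finset.sort_nodup _ _)
        (fun a => by rw [Finset.mem_sort, Finset.mem_image]) g
    have h3 : (KC A (wordString ι (F n) (shiftAct g ω)) : ℝ) ≤
        KC A (wordString ι (F n) ω) + (c * ((Nat.log 2 n : ℝ) + 1) +
          c * ((symmDiff (F n) (F n * {g})).card : ℝ)) := by
      exact_mod_cast h1.trans (by gcongr; exact le_rfl)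
    calc _ ≤ (KC A (wordString ι (F n) ω) + (c * ((Nat.log 2 n : ℝ) + 1) +
          c * ((symmDiff (F n) (F n * {g})).card : ℝ))) / (F n).card := by gcongr
      _ = _ := by ring

theorem Khat_shiftAct (hcg : IsComputableGroup ι) (hF : IsRightFolner F)
    (hcc : CanonicallyComputable ι F)
    (hgrowth : Tendsto (fun n => ((F n).card : ℝ) / Real.log n) atTop atTop)
    (hA : IsOptimalDecompressor A) (g : Γ) (ω : Γ → Λ) :
    Khat A ι F (shiftAct g ω) = Khat A ι F ω := by
  obtain ⟨δ, hδ, h⟩ := exists_KC_shiftAct_div_card_le hcg hF hcc hgrowth hA g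
  obtain ⟨δ', hδ', h'⟩ := exists_KC_shiftAct_div_card_le hcg hF hcc hgrowth hA g⁻¹
  refine limsup_eq_limsup_of_le_add_of_tendsto_zero (fun n => by positivity)
    (fun n => by positivity) hδ hδ' (h ω) fun n => ?_
  simpa only [shiftAct_shiftAct, inv_mul_cancel, shiftAct_one] using h' (shiftAct g ω) n

end Shift

theorem stmt8 {Γ : Type*} [Group Γ] [Countable Γ] [Infinite Γ] [DecidableEq Γ]
    {Λ : Type*} [Fintype Λ] [Primcodable Λ] [TopologicalSpace Λ] [DiscreteTopology Λ]
    [MeasurableSpace Λ] [MeasurableSingletonClass Λ]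
    (ι : Γ → ℕ) (hcg : IsComputableGroup ι)
    (F : ℕ → Finset Γ) (hF : IsRightFolner F) (hcc : CanonicallyComputable ι F)
    (hgrowth : Tendsto (fun n => ((F n).card : ℝ) / Real.log n) atTop atTop)
    (A : List Bool →. List Λ) (hA : IsOptimalDecompressor A)
    (X : Set (Γ → Λ)) (hXne : X.Nonempty) (hXcl : IsClosed X)
    (hXinv : ∀ (g : Γ), ∀ ω ∈ X, shiftAct g ω ∈ X)
    (t : ℝ) (ht : 0 ≤ t) :
    (MeasurableSet {ω | ω ∈ X ∧ Khat A ι F ω = t} ∧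
      ∀ g : Γ, shiftAct g '' {ω | ω ∈ X ∧ Khat A ι F ω = t} =
        {ω | ω ∈ X ∧ Khat A ι F ω = t}) ∧
    (MeasurableSet {ω | ω ∈ X ∧ Khat A ι F ω < t} ∧
      ∀ g : Γ, shiftAct g '' {ω | ω ∈ X ∧ Khat A ι F ω < t} =
        {ω | ω ∈ X ∧ Khat A ι F ω < t}) ∧
    (MeasurableSet {ω | ω ∈ X ∧ t < Khat A ι F ω} ∧
      ∀ g : Γ, shiftAct g '' {ω | ω ∈ X ∧ t < Khat A ι F ω} =
        {ω | ω ∈ X ∧ t < Khat A ι F ω}) := by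
  have hXm : MeasurableSet X := hXcl.measurableSet
  have hK := measurable_Khat A ι F
  have hinv := Khat_shiftAct hcg hF hcc hgrowth hA
  refine ⟨⟨hXm.inter (hK (measurableSet_singleton t)), ?_⟩,
    ⟨hXm.inter (hK measurableSet_Iio), ?_⟩, ⟨hXm.inter (hK measurableSet_Ioi), ?_⟩⟩ <;>
  exact shiftAct_image_sep hXinv fun g ω h => by rwa [hinv g ω]
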